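/- Let R be an integral domain and M a reduced torsion-free cancellative commutative monoid that satisfies ACCP. Then R is a weak-ACCP domain if and only if the monoid ring R[M] is a weak-ACCP domain. -/

import Mathlib

-- additive notions, for the exponent monoid
def PIdeal {M : Type*} [AddCommMonoid M] (b : M) : Set M := {x | ∃ c, x = b + c}

def ElemACCP {M : Type*} [AddCommMonoid M] (b : M) : Prop :=
  ∀ f : ℕ → M, f 0 = b → (∀ n, PIdeal (f n) ⊆ PIdeal (f (n + 1))) →
    ∃ N, ∀ n, N ≤ n → PIdeal (f n) = PIdeal (f N)

def AddACCP (M : Type*) [AddCommMonoid M] : Prop := ∀ b : M, ElemACCP b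

-- multiplicative notions, for rings
def ACCPat {R : Type*} [CommRing R] (r : R) : Prop :=
  ∀ f : ℕ → R, f 0 = r → (∀ n, f (n + 1) ∣ f n) →
    ∃ N, ∀ n, N ≤ n → Ideal.span {f n} = Ideal.span {f N}

def AtomicDom (R : Type*) [CommRing R] : Prop :=
  ∀ r : R, r ≠ 0 → ¬ IsUnit r → ∃ l : Multiset R, (∀ a ∈ l, Irreducible a) ∧ l.prod = r

def WeakACCPDom (R : Type*) [CommRing R] : Prop :=
  AtomicDom R ∧ ∀ S : Finset R, S.Nonempty → (∀ s ∈ S, s ≠ (0 : R)) →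
    ∃ d : R, (∀ s ∈ S, d ∣ s) ∧ ∃ s ∈ S, ∃ c, s = d * c ∧ ACCPat c

open AddMonoidAlgebra Function

section DivisorChains

variable {R A : Type*} [CommRing R] [CommRing A]

theorem span_singleton_eq_iff_dvd_dvd {x y : A} :
    Ideal.span {x} = Ideal.span {y} ↔ x ∣ y ∧ y ∣ x := by
  rw [le_antisymm_iff, Ideal.span_singleton_le_span_singleton,
    Ideal.span_singleton_le_span_singleton, and_comm]

/-- An element satisfying ACCP is accessible for strict divisibility. -/
theorem ACCPat.acc_dvdNotUnit [IsDomain A] {x : A} (h : ACCPat x) : Acc DvdNotUnit x := by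
  by_contra hx
  obtain ⟨f, hf0, hf⟩ := not_acc_iff_exists_descending_chain.mp hx
  obtain ⟨N, hN⟩ := h f hf0 fun n => let ⟨_, d, _, he⟩ := hf n; ⟨d, he⟩
  obtain ⟨c, hc⟩ := (span_singleton_eq_iff_dvd_dvd.mp (hN (N + 1) N.le_succ)).2
  obtain ⟨h0, d, hd, he⟩ := hf N
  refine hd (.of_mul_eq_one c (mul_left_cancel₀ h0 ?_))
  rw [← mul_assoc, ← he, ← hc, mul_one]

/-- `x` is a product of irreducible elements, up to a unit. -/
def HasFactors (x : A) : Prop :=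
  ∃ l : Multiset A, (∀ a ∈ l, Irreducible a) ∧ Associated l.prod x

theorem HasFactors.mul {x y : A} (hx : HasFactors x) (hy : HasFactors y) :
    HasFactors (x * y) := by
  obtain ⟨l, hl, hlx⟩ := hx
  obtain ⟨m, hm, hmy⟩ := hy
  refine ⟨l + m, fun a ha => ?_, by rw [Multiset.prod_add]; exact hlx.mul_mul hmy⟩
  exact (Multiset.mem_add.mp ha).elim (hl a) (hm a)

theorem HasFactors.of_isUnit {x : A} (hx : IsUnit x) : HasFactors x :=
  ⟨0, by simp, by simpa using (associated_one_iff_isUnit.mpr hx).symm⟩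

theorem hasFactors_of_acc [IsDomain A] {x : A} (h : Acc DvdNotUnit x) :
    x ≠ 0 → HasFactors x := by
  induction h with
  | intro x _ ih =>
    intro hx
    by_cases hu : IsUnit x
    · exact .of_isUnit hu
    by_cases hirr : Irreducible x
    · exact ⟨{x}, by simpa using hirr, by simp⟩
    obtain ⟨a, b, ha, hb, rfl⟩ : ∃ a b, ¬ IsUnit a ∧ ¬ IsUnit b ∧ x = a * b := by
      by_contra! hab
      exact hirr ⟨hu, fun a b he => or_iff_not_imp_left.mpr fun ha =>
        not_not.mp fun hb => hab a b ha hb he⟩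
    have ha0 := left_ne_zero_of_mul hx
    have hb0 := right_ne_zero_of_mul hx
    exact (ih a ⟨ha0, b, hb, rfl⟩ ha0).mul (ih b ⟨hb0, a, ha, mul_comm a b⟩ hb0)

theorem atomicDom_of_hasFactors (h : ∀ x : A, x ≠ 0 → HasFactors x) : AtomicDom A := by
  intro x hx hu
  obtain ⟨l, hl, u, rfl⟩ := h x hx
  rcases Multiset.empty_or_exists_mem l with rfl | ⟨a, ha⟩
  · exact (hu (by simp)).elim
  obtain ⟨m, rfl⟩ := Multiset.exists_cons_of_mem ha
  refine ⟨(a * u) ::ₘ m, fun b hb => ?_, by simp only [Multiset.prod_cons]; ring⟩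
  rcases Multiset.mem_cons.mp hb with rfl | hb
  · exact (irreducible_mul_units u).mpr (hl a ha)
  · exact hl b (Multiset.mem_cons_of_mem hb)

theorem AtomicDom.hasFactors (h : AtomicDom A) {x : A} (hx : x ≠ 0) : HasFactors x := by
  by_cases hu : IsUnit x
  · exact .of_isUnit hu
  · obtain ⟨l, hl, rfl⟩ := h x hx hu
    exact ⟨l, hl, .refl _⟩

/-- A ring homomorphism is divisor closed if every divisor of the image of a nonzero element
lies in the range. -/
def DivisorClosed (φ : R →+* A) : Prop :=
  ∀ r : R, r ≠ 0 → ∀ x : A, x ∣ φ r → ∃ s, φ s = x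

variable {φ : R →+* A}

theorem DivisorClosed.map_dvd_map_iff (hφ : DivisorClosed φ) (hinj : Injective φ) {a b : R} :
    φ a ∣ φ b ↔ a ∣ b := by
  refine ⟨fun ⟨x, hx⟩ => ?_, map_dvd φ⟩
  rcases eq_or_ne b 0 with rfl | hb
  · exact dvd_zero a
  obtain ⟨s, rfl⟩ := hφ b hb x ⟨φ a, by rw [hx, mul_comm]⟩
  exact ⟨s, hinj (by rw [hx, map_mul])⟩

theorem DivisorClosed.isUnit_map_iff (hφ : DivisorClosed φ) (hinj : Injective φ) {a : R} :
    IsUnit (φ a) ↔ IsUnit a := by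
  rw [isUnit_iff_dvd_one, isUnit_iff_dvd_one, ← hφ.map_dvd_map_iff hinj, map_one]

theorem DivisorClosed.irreducible_map_iff [IsDomain R] (hφ : DivisorClosed φ)
    (hinj : Injective φ) {a : R} : Irreducible (φ a) ↔ Irreducible a := by
  rcases eq_or_ne a 0 with rfl | ha
  · rw [map_zero]
    exact ⟨fun h => (h.ne_zero rfl).elim, fun h => (h.ne_zero rfl).elim⟩
  simp only [irreducible_iff, hφ.isUnit_map_iff hinj]
  refine and_congr_right fun _ => ⟨fun h s t hst => ?_, fun h x y hxy => ?_⟩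
  · have := @h (φ s) (φ t)
    rw [hφ.isUnit_map_iff hinj, hφ.isUnit_map_iff hinj] at this
    exact this (by rw [hst, map_mul])
  · obtain ⟨s, rfl⟩ := hφ a ha x ⟨y, hxy⟩
    obtain ⟨t, rfl⟩ := hφ a ha y ⟨φ s, by rw [hxy, mul_comm]⟩
    rw [hφ.isUnit_map_iff hinj, hφ.isUnit_map_iff hinj]
    exact h (hinj (by rw [hxy, map_mul]))

theorem HasFactors.map [IsDomain R] (hφ : DivisorClosed φ) (hinj : Injective φ) {x : R}
    (hx : HasFactors x) : HasFactors (φ x) := by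
  obtain ⟨l, hl, hlx⟩ := hx
  refine ⟨l.map φ, fun a ha => ?_, by rw [← map_multiset_prod]; exact hlx.map φ⟩
  obtain ⟨b, hb, rfl⟩ := Multiset.mem_map.mp ha
  exact (hφ.irreducible_map_iff hinj).mpr (hl b hb)

theorem DivisorClosed.accpat_of_map (hφ : DivisorClosed φ) (hinj : Injective φ) {r : R}
    (h : ACCPat (φ r)) : ACCPat r := by
  intro f hf0 hf
  obtain ⟨N, hN⟩ := h (fun n => φ (f n)) (by rw [hf0]) fun n => map_dvd φ (hf n)
  refine ⟨N, fun n hn => ?_⟩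
  have := hN n hn
  rwa [span_singleton_eq_iff_dvd_dvd, hφ.map_dvd_map_iff hinj, hφ.map_dvd_map_iff hinj,
    ← span_singleton_eq_iff_dvd_dvd] at this

theorem DivisorClosed.atomicDom [IsDomain R] (hφ : DivisorClosed φ) (hinj : Injective φ)
    (h : AtomicDom A) : AtomicDom R := by
  intro r hr hu
  obtain ⟨l, hl, hlr⟩ := h (φ r) ((map_ne_zero_iff φ hinj).mpr hr)
    (mt (hφ.isUnit_map_iff hinj).mp hu)
  have hrange : ∀ a ∈ l, ∃ s, φ s = a := fun a ha =>
    hφ r hr a (hlr ▸ Multiset.dvd_prod ha)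
  obtain ⟨m, rfl⟩ : ∃ m : Multiset R, m.map φ = l := by
    refine ⟨l.map (invFun φ), ?_⟩
    rw [Multiset.map_map]
    exact (Multiset.map_congr rfl fun a ha => invFun_eq (hrange a ha)).trans l.map_id
  refine ⟨m, fun a ha => ?_, hinj (by rw [map_multiset_prod, hlr])⟩
  exact (hφ.irreducible_map_iff hinj).mp (hl _ (Multiset.mem_map_of_mem φ ha))

theorem DivisorClosed.weakACCPDom [IsDomain R] (hφ : DivisorClosed φ) (hinj : Injective φ)
    (h : WeakACCPDom A) : WeakACCPDom R := by
  classical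
  refine ⟨hφ.atomicDom hinj h.1, fun S hS hS0 => ?_⟩
  obtain ⟨d, hd, s, hs, c, hsc, hc⟩ := h.2 (S.image φ) (hS.image φ) (by
    simp only [Finset.mem_image, forall_exists_index, and_imp, forall_apply_eq_imp_iff₂]
    exact fun s hs => (map_ne_zero_iff φ hinj).mpr (hS0 s hs))
  obtain ⟨t, ht, rfl⟩ := Finset.mem_image.mp hs
  obtain ⟨e, rfl⟩ := hφ t (hS0 t ht) d ⟨c, hsc⟩
  obtain ⟨k, rfl⟩ := hφ t (hS0 t ht) c ⟨φ e, by rw [hsc, mul_comm]⟩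
  exact ⟨e, fun s hs => (hφ.map_dvd_map_iff hinj).mp (hd _ (Finset.mem_image_of_mem φ hs)),
    t, ht, k, hinj (by rw [hsc, map_mul]), hφ.accpat_of_map hinj hc⟩

end DivisorChains

theorem injective_neg_addMonoidHom {M B : Type*} [AddMonoid M] [AddCommGroup B] {D : M →+ B}
    (hD : Injective D) : Injective (-D) :=
  fun a b h => hD (by simpa using h)

section Exponents

variable {R M B : Type*} [CommRing R] [AddCancelCommMonoid M]
  [AddCommGroup B] [LinearOrder B]

theorem singleZeroRingHom_eq_single (r : R) : (singleZeroRingHom r : R[M]) = single 0 r :=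
  rfl

theorem singleZeroRingHom_injective : Injective (singleZeroRingHom : R →+* R[M]) :=
    fun r s h => by
  simpa [singleZeroRingHom_eq_single] using congrArg (fun f : R[M] => f.coeff 0) h

/-- `m` is the exponent of the leading term of `f`, exponents being compared through `D`. -/
def IsLeadingExp (D : M →+ B) (f : R[M]) (m : M) : Prop :=
  m ∈ f.coeff.support ∧ ∀ x ∈ f.coeff.support, D x ≤ D m

theorem exists_isLeadingExp (D : M →+ B) {f : R[M]} (hf : f ≠ 0) :
    ∃ m, IsLeadingExp D f m := by
  obtain ⟨m, hm, h⟩ := f.coeff.support.exists_max_image D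
    (by rwa [Finsupp.support_nonempty_iff, ne_eq, coeff_eq_zero])
  exact ⟨m, hm, h⟩

theorem IsLeadingExp.unique {D : M →+ B} (hD : Injective D) {f : R[M]} {m n : M}
    (hm : IsLeadingExp D f m) (hn : IsLeadingExp D f n) : m = n :=
  hD (le_antisymm (hn.2 m hm.1) (hm.2 n hn.1))

variable [IsOrderedAddMonoid B]

theorem IsLeadingExp.mul [IsDomain R] {D : M →+ B} (hD : Injective D) {f g : R[M]} {m n : M}
    (hm : IsLeadingExp D f m) (hn : IsLeadingExp D g n) :
    IsLeadingExp D (f * g) (m + n) := by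
  classical
  have huniq : UniqueAdd f.coeff.support g.coeff.support m n := by
    intro a b ha hb hab
    have h1 := hm.2 a ha
    have h2 := hn.2 b hb
    have h3 : D a + D b = D m + D n := by rw [← map_add, hab, map_add]
    constructor
    · exact hD (le_antisymm h1 (by by_contra! hlt; exact (add_lt_add_of_lt_of_le hlt h2).ne h3))
    · exact hD (le_antisymm h2 (by by_contra! hlt; exact (add_lt_add_of_le_of_lt h1 hlt).ne h3))
  refine ⟨?_, fun x hx => ?_⟩
  · rw [Finsupp.mem_support_iff, coeff_mul_add_of_uniqueAdd huniq]
    exact mul_ne_zero (Finsupp.mem_support_iff.mp hm.1) (Finsupp.mem_support_iff.mp hn.1)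
  · obtain ⟨a, ha, b, hb, rfl⟩ := Finset.mem_add.mp (support_coeff_mul_subset f g hx)
    rw [map_add, map_add]
    exact add_le_add (hm.2 a ha) (hn.2 b hb)

theorem eq_single_zero_of_isLeadingExp {D : M →+ B} (hD : Injective D) {f : R[M]}
    (htop : IsLeadingExp D f 0) (hbot : IsLeadingExp (-D) f 0) :
    f = single 0 (f.coeff 0) := by
  ext m
  by_cases hm : m = 0
  · simp [hm]
  rw [coeff_single, Finsupp.single_eq_of_ne hm]
  by_contra h
  have h' := Finsupp.mem_support_iff.mpr h
  have h1 := htop.2 m h'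
  have h2 := hbot.2 m h'
  simp only [AddMonoidHom.neg_apply, map_zero, Left.neg_nonpos_iff] at h1 h2
  exact hm (hD (by rw [map_zero]; exact le_antisymm h1 h2))

/-- Along a chain of divisors of a nonzero element, the leading exponents of the successive
quotients eventually vanish. -/
theorem eventually_isLeadingExp_zero [IsDomain R] {D : M →+ B} (hD : Injective D)
    (hred : ∀ a : M, IsAddUnit a → a = 0) (haccp : AddACCP M) {f g : ℕ → R[M]}
    (hf : ∀ n, f n ≠ 0) (hg : ∀ n, g n ≠ 0) (hfg : ∀ n, f n = f (n + 1) * g n) :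
    ∃ N, ∀ n, N ≤ n → IsLeadingExp D (g n) 0 := by
  choose a ha using fun n => exists_isLeadingExp D (hf n)
  choose b hb using fun n => exists_isLeadingExp D (hg n)
  have hab : ∀ n, a n = a (n + 1) + b n := fun n =>
    (ha n).unique hD (hfg n ▸ (ha (n + 1)).mul hD (hb n))
  obtain ⟨N, hN⟩ := haccp (a 0) a rfl (by
    rintro n _ ⟨c, rfl⟩
    exact ⟨b n + c, by rw [hab n, add_assoc]⟩)
  refine ⟨N, fun n hn => ?_⟩
  have hmem : a (n + 1) ∈ PIdeal (a n) := by
    rw [hN n hn, ← hN (n + 1) (by omega)]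
    exact ⟨0, (add_zero _).symm⟩
  obtain ⟨c, hc⟩ := hmem
  have hbc : b n + c = 0 := by
    rw [hab n, add_assoc] at hc
    exact left_eq_add.mp hc
  have hb0 := hred (b n) (.of_add_eq_zero c hbc)
  exact hb0 ▸ hb n

theorem divisorClosed_singleZeroRingHom [IsDomain R] {D : M →+ B} (hD : Injective D)
    (hred : ∀ a : M, IsAddUnit a → a = 0) :
    DivisorClosed (singleZeroRingHom : R →+* R[M]) := by
  rintro r hr x ⟨y, hxy⟩
  rw [singleZeroRingHom_eq_single] at hxy
  have hne : x * y ≠ 0 := by rw [← hxy]; simpa using hr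
  have key : ∀ E : M →+ B, Injective E → IsLeadingExp E x 0 := by
    intro E hE
    obtain ⟨a, ha⟩ := exists_isLeadingExp E (left_ne_zero_of_mul hne)
    obtain ⟨b, hb⟩ := exists_isLeadingExp E (right_ne_zero_of_mul hne)
    have hab := ha.mul hE hb
    rw [← hxy] at hab
    have h0 : a + b = 0 := by
      have := hab.1
      rw [coeff_single] at this
      simpa using Finsupp.support_single_subset this
    exact hred a (.of_add_eq_zero b h0) ▸ ha
  exact ⟨x.coeff 0, (eq_single_zero_of_isLeadingExp hD (key D hD)
    (key _ (injective_neg_addMonoidHom hD))).symm⟩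

theorem isDomain_of_injective_addMonoidHom [IsDomain R] {D : M →+ B} (hD : Injective D) :
    IsDomain R[M] :=
  haveI : UniqueSums M := .of_injective_addHom D.toAddHom hD inferInstance
  inferInstance

/-- An element with a nonzero coefficient satisfying ACCP satisfies ACCP. -/
theorem accpat_of_coeff [IsDomain R] {D : M →+ B} (hD : Injective D)
    (hred : ∀ a : M, IsAddUnit a → a = 0) (haccp : AddACCP M) {h : R[M]} {m : M}
    (hm : h.coeff m ≠ 0) (hacc : ACCPat (h.coeff m)) : ACCPat h := by
  have := isDomain_of_injective_addMonoidHom (R := R) hD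
  have hh : h ≠ 0 := by rintro rfl; simp at hm
  intro f hf0 hdvd
  choose g hfg using hdvd
  have hdvd0 : ∀ n, f n ∣ h := by
    intro n
    induction n with
    | zero => rw [hf0]
    | succ n ih => exact (Dvd.intro _ (hfg n).symm).trans ih
  have hf : ∀ n, f n ≠ 0 := fun n => ne_zero_of_dvd_ne_zero hh (hdvd0 n)
  have hg : ∀ n, g n ≠ 0 := fun n => right_ne_zero_of_mul (hfg n ▸ hf n)
  obtain ⟨N₁, hN₁⟩ := eventually_isLeadingExp_zero hD hred haccp hf hg hfg
  obtain ⟨N₂, hN₂⟩ := eventually_isLeadingExp_zero (injective_neg_addMonoidHom hD) hred haccp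
    hf hg hfg
  obtain ⟨N, hN⟩ : ∃ N, ∀ n, N ≤ n → g n = single 0 ((g n).coeff 0) :=
    ⟨max N₁ N₂, fun n hn => eq_single_zero_of_isLeadingExp hD (hN₁ n (by omega))
      (hN₂ n (by omega))⟩
  obtain ⟨u, hu⟩ := hdvd0 N
  have hstep : ∀ k, (f (N + k) * u).coeff m =
      (f (N + (k + 1)) * u).coeff m * (g (N + k)).coeff 0 := by
    intro k
    conv_lhs => rw [hfg (N + k), mul_right_comm, hN (N + k) (by omega)]
    rw [coeff_mul_single_zero, add_assoc]
  have hne : ∀ k, (f (N + k) * u).coeff m ≠ 0 := by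
    intro k
    induction k with
    | zero => rwa [add_zero, ← hu]
    | succ k ih => exact left_ne_zero_of_mul (hstep k ▸ ih)
  obtain ⟨K, hK⟩ := hacc (fun k => (f (N + k) * u).coeff m) (by rw [add_zero, ← hu])
    fun k => Dvd.intro _ (hstep k).symm
  have hunit : ∀ n, N + K ≤ n → IsUnit (g n) := by
    intro n hn
    obtain ⟨k, rfl⟩ := Nat.exists_eq_add_of_le (show N ≤ n by omega)
    have hspan := (hK k (by omega)).trans (hK (k + 1) (by omega)).symm
    obtain ⟨c, hc⟩ := (span_singleton_eq_iff_dvd_dvd.mp hspan).1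
    have hmul : (g (N + k)).coeff 0 * c = 1 := by
      refine mul_left_cancel₀ (hne (k + 1)) ?_
      rw [← mul_assoc, ← hstep k, ← hc, mul_one]
    rw [hN (N + k) (by omega)]
    exact (IsUnit.of_mul_eq_one c hmul).map (singleZeroRingHom : R →+* R[M])
  refine ⟨N + K, fun n hn => ?_⟩
  induction n, hn using Nat.le_induction with
  | base => rfl
  | succ n hn ih =>
    rw [← ih, hfg n]
    exact (Ideal.span_singleton_mul_right_unit (hunit n hn) _).symm

theorem singleZeroRingHom_dvd_of_forall_coeff {d : R} {f : R[M]}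
    (h : ∀ m ∈ f.coeff.support, d ∣ f.coeff m) : (singleZeroRingHom d : R[M]) ∣ f := by
  rw [← sum_coeff_single f]
  refine Finset.dvd_sum fun m hm => ?_
  obtain ⟨k, hk⟩ := h m hm
  exact ⟨single m k, by rw [hk, singleZeroRingHom_eq_single, single_mul_single, zero_add]⟩

theorem WeakACCPDom.exists_const_dvd [IsDomain R] {D : M →+ B} (hD : Injective D)
    (hred : ∀ a : M, IsAddUnit a → a = 0) (haccp : AddACCP M) (hR : WeakACCPDom R)
    {S : Finset R[M]} (hS : S.Nonempty) (hS0 : ∀ s ∈ S, s ≠ 0) :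
    ∃ d : R, (∀ s ∈ S, (singleZeroRingHom d : R[M]) ∣ s) ∧
      ∃ s ∈ S, ∃ c, s = singleZeroRingHom d * c ∧ ACCPat c := by
  classical
  obtain ⟨d, hd, t, ht, c, htc, hc⟩ :=
    hR.2 (S.biUnion fun s => s.coeff.support.image s.coeff) (by
      obtain ⟨s, hs⟩ := hS
      refine Finset.Nonempty.biUnion ⟨s, hs⟩ fun s hs => Finset.Nonempty.image ?_ _
      rw [Finsupp.support_nonempty_iff, ne_eq, coeff_eq_zero]
      exact hS0 s hs) (by
      simp only [Finset.mem_biUnion, Finset.mem_image]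
      rintro _ ⟨s, _, m, hm, rfl⟩
      exact Finsupp.mem_support_iff.mp hm)
  simp only [Finset.mem_biUnion, Finset.mem_image] at hd ht
  have hdvd : ∀ s ∈ S, (singleZeroRingHom d : R[M]) ∣ s := fun s hs =>
    singleZeroRingHom_dvd_of_forall_coeff fun m hm => hd _ ⟨s, hs, m, hm, rfl⟩
  obtain ⟨s, hs, m, hm, rfl⟩ := ht
  obtain ⟨h, hh⟩ := hdvd s hs
  have hne : d * c ≠ 0 := htc ▸ Finsupp.mem_support_iff.mp hm
  have hcoeff : h.coeff m = c := by
    refine mul_left_cancel₀ (left_ne_zero_of_mul hne) ?_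
    rw [← htc, hh, singleZeroRingHom_eq_single, coeff_single_zero_mul]
  refine ⟨d, hdvd, s, hs, h, hh, accpat_of_coeff hD hred haccp (m := m) ?_ ?_⟩
  · exact hcoeff ▸ right_ne_zero_of_mul hne
  · exact hcoeff ▸ hc

theorem WeakACCPDom.addMonoidAlgebra [IsDomain R] {D : M →+ B} (hD : Injective D)
    (hred : ∀ a : M, IsAddUnit a → a = 0) (haccp : AddACCP M) (hR : WeakACCPDom R) :
    WeakACCPDom R[M] := by
  have := isDomain_of_injective_addMonoidHom (R := R) hD
  refine ⟨atomicDom_of_hasFactors fun f hf => ?_, fun S hS hS0 => ?_⟩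
  · obtain ⟨d, -, s, hs, c, hsc, hc⟩ := hR.exists_const_dvd hD hred haccp
      (S := {f}) (by simp) (by simpa using hf)
    obtain rfl := Finset.mem_singleton.mp hs
    rw [hsc] at hf ⊢
    refine HasFactors.mul ?_ (hasFactors_of_acc hc.acc_dvdNotUnit (right_ne_zero_of_mul hf))
    refine (hR.1.hasFactors ?_).map (divisorClosed_singleZeroRingHom hD hred)
      singleZeroRingHom_injective
    rintro rfl
    exact left_ne_zero_of_mul hf (map_zero _)
  · obtain ⟨d, hd, hs⟩ := hR.exists_const_dvd hD hred haccp hS hS0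
    exact ⟨_, hd, hs⟩

end Exponents

theorem exists_injective_addMonoidHom_lex.{u} (M : Type u) [AddCancelCommMonoid M]
    [IsAddTorsionFree M] :
    ∃ (ι : Type u) (_ : LinearOrder ι) (D : M →+ Lex (ι →₀ ℚ)), Injective D := by
  classical
  let b := Module.Basis.ofVectorSpace ℚ (DivisibleHull (Algebra.GrothendieckAddGroup M))
  let E : M →+ DivisibleHull (Algebra.GrothendieckAddGroup M) :=
    (DivisibleHull.coeAddMonoidHom _).comp (AddLocalization.addMonoidOf ⊤).toAddMonoidHom
  have hE : Injective E := by
    exact DivisibleHull.coe_injective.comp (AddLocalization.mk_left_injective 0)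
  exact ⟨_, linearOrderOfSTO WellOrderingRel,
    { toFun := fun m => toLex (b.repr (E m))
      map_zero' := by simp
      map_add' := by simp },
    toLex.injective.comp (b.repr.injective.comp hE)⟩

theorem stmt12 (R : Type*) [CommRing R] [IsDomain R]
    (M : Type*) [AddCancelCommMonoid M]
    (hred : ∀ a : M, IsAddUnit a → a = 0)
    (htf : ∀ (n : ℕ) (b c : M), n ≠ 0 → n • b = n • c → b = c)
    (haccp : AddACCP M) :
    WeakACCPDom R ↔ WeakACCPDom (AddMonoidAlgebra R M) := by
  have : IsAddTorsionFree M := ⟨fun n hn b c h => htf n b c hn h⟩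
  obtain ⟨ι, _, D, hD⟩ := exists_injective_addMonoidHom_lex M
  exact ⟨.addMonoidAlgebra hD hred haccp,
    (divisorClosed_singleZeroRingHom hD hred).weakACCPDom singleZeroRingHom_injective⟩
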